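/- Let 𝒳 be a compact interval of length L > 0 and x_1,…,x_n equispaced points of 𝒳 with x_{i+1} − x_i = L/n for all i ∈ {1,…,n−1}. Let f ∈ C_k with total variation V = V(f) and 𝒥-variation-index W = W_𝒥(f). Then for every γ > 0 there exists a ⌊2(k+γ)⌋-piecewise linear function f̄ ∈ C_k such that (1/n)·Σ_{i=1}^n |f(x_i) − f̄(x_i)| ≤ W/γ² + 2V/n. -/

import Mathlib

open Filter
open scoped ENNReal
attribute [local instance] Classical.propDecidable

/-- `P` is a partition of `𝒳` into nontrivial intervals. -/
def IsIntervalPartition (𝒳 : Set ℝ) (P : Finset (Set ℝ)) : Prop :=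
  (∀ J ∈ P, J.OrdConnected ∧ J.Nontrivial ∧ J ⊆ 𝒳) ∧
  ∀ y ∈ 𝒳, ∃! J, J ∈ P ∧ y ∈ J

/-- `P` is a partition of `𝒳` into (possibly trivial) intervals. -/
def IsIntervalPartition' (𝒳 : Set ℝ) (P : Finset (Set ℝ)) : Prop :=
  (∀ J ∈ P, J.OrdConnected ∧ J ⊆ 𝒳) ∧
  ∀ y ∈ 𝒳, ∃! J, J ∈ P ∧ y ∈ J

/-- `f` is `k`-piecewise monotone-convex-concave on `𝒳`. -/
def PiecewiseMCC (𝒳 : Set ℝ) (k : ℕ) (f : ℝ → ℝ) : Prop :=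
  ContinuousOn f 𝒳 ∧
  ∃ P : Finset (Set ℝ), P.card ≤ k ∧ IsIntervalPartition 𝒳 P ∧
    ∀ J ∈ P, (MonotoneOn f (closure J) ∨ AntitoneOn f (closure J)) ∧
      (ConvexOn ℝ (closure J) f ∨ ConcaveOn ℝ (closure J) f)

/-- `f` is `K`-piecewise linear on `𝒳`. -/
def PiecewiseLinear (𝒳 : Set ℝ) (K : ℕ) (f : ℝ → ℝ) : Prop :=
  ContinuousOn f 𝒳 ∧
  ∃ P : Finset (Set ℝ), P.card ≤ K ∧ IsIntervalPartition' 𝒳 P ∧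
    ∀ J ∈ P, ∃ a b : ℝ, ∀ y ∈ J, f y = a * y + b

/-- The number of design points falling in `J`. -/
noncomputable def nPts {n : ℕ} (x : Fin n → ℝ) (J : Set ℝ) : ℕ :=
  (Finset.univ.filter fun i => x i ∈ J).card

/-- The variation `V_J(f) = sup_J f − inf_J f` of `f` on the closure of `J`. -/
noncomputable def realVarOn (f : ℝ → ℝ) (J : Set ℝ) : ℝ :=
  sSup (f '' closure J) - sInf (f '' closure J)

/-- Division in `[0,∞]` with the convention `0/0 = 1` (and `x/∞ = 0`). -/
noncomputable def cdiv (x y : ℝ≥0∞) : ℝ≥0∞ := if x = 0 ∧ y = 0 then 1 else x / y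

/-- The linear index computed from the one-sided derivatives `dra`, `dlb` and the
chord slope `Δ`, with conventions `0/0 = 1` and `1/∞ = 0`. -/
noncomputable def linIndex (dra dlb : EReal) (Δ : ℝ) : ℝ :=
  1 - (1 / 2) * ((cdiv (min dra.abs dlb.abs) (ENNReal.ofReal |Δ|)).toReal
      + (cdiv (ENNReal.ofReal |Δ|) (max dra.abs dlb.abs)).toReal)

open Set

lemma ConvexOn.chord_mul_le {f : ℝ → ℝ} {s : Set ℝ} (hf : ConvexOn ℝ s f) {x y z : ℝ}
    (hx : x ∈ s) (hz : z ∈ s) (hxy : x ≤ y) (hyz : y ≤ z) :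
    (z - x) * f y ≤ (z - y) * f x + (y - x) * f z := by
  rcases hxy.eq_or_lt with rfl | hxy
  · linarith
  rcases hyz.eq_or_lt with rfl | hyz
  · linarith
  exact hf.secant_mono_aux1 hx hz hxy hyz

/-- The line through the points of the graph of `f` above `u` and `v`. -/
noncomputable def chordLine (f : ℝ → ℝ) (u v x : ℝ) : ℝ :=
  f u + (f v - f u) / (v - u) * (x - u)

lemma chordLine_left (f : ℝ → ℝ) (u v : ℝ) : chordLine f u v u = f u := by
  simp [chordLine]

lemma chordLine_right (f : ℝ → ℝ) {u v : ℝ} (h : u < v) : chordLine f u v v = f v := by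
  have : v - u ≠ 0 := by linarith
  simp only [chordLine]
  field_simp
  ring

lemma mul_chordLine_sub (f : ℝ → ℝ) {u v : ℝ} (h : u < v) (x y : ℝ) :
    (v - u) * (chordLine f u v x - y) = (f v - f u) * (x - u) - (v - u) * (y - f u) := by
  have : v - u ≠ 0 := by linarith
  simp only [chordLine]
  field_simp
  ring

lemma le_chordLine {f : ℝ → ℝ} {s : Set ℝ} (hf : ConvexOn ℝ s f) {u v x : ℝ} (hu : u ∈ s)
    (hv : v ∈ s) (huv : u < v) (hx : x ∈ Icc u v) : f x ≤ chordLine f u v x := by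
  have h1 := hf.chord_mul_le hu hv hx.1 hx.2
  have h2 := mul_chordLine_sub f huv x (f x)
  have : 0 ≤ (v - u) * (chordLine f u v x - f x) := by rw [h2]; linarith
  have := nonneg_of_mul_nonneg_right this (by linarith)
  linarith

lemma chordLine_le_of_ge {f : ℝ → ℝ} {s : Set ℝ} (hf : ConvexOn ℝ s f) {u v x : ℝ} (hu : u ∈ s)
    (hx : x ∈ s) (huv : u < v) (hvx : v ≤ x) : chordLine f u v x ≤ f x := by
  have h1 := hf.chord_mul_le hu hx huv.le hvx
  have h2 := mul_chordLine_sub f huv x (f x)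
  have : (v - u) * (chordLine f u v x - f x) ≤ 0 := by rw [h2]; linarith
  have := nonpos_of_mul_nonpos_right this (by linarith)
  linarith

lemma chordLine_le_of_le {f : ℝ → ℝ} {s : Set ℝ} (hf : ConvexOn ℝ s f) {u v x : ℝ} (hv : v ∈ s)
    (hx : x ∈ s) (huv : u < v) (hxu : x ≤ u) : chordLine f u v x ≤ f x := by
  have h1 := hf.chord_mul_le hx hv hxu huv.le
  have h2 := mul_chordLine_sub f huv x (f x)
  have : (v - u) * (chordLine f u v x - f x) ≤ 0 := by rw [h2]; linarith
  have := nonpos_of_mul_nonpos_right this (by linarith)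
  linarith

lemma chordLine_combo (f : ℝ → ℝ) (u v x y a b : ℝ) (hab : a + b = 1) :
    chordLine f u v (a * x + b * y) = a * chordLine f u v x + b * chordLine f u v y := by
  simp only [chordLine]
  linear_combination (-f u + (f v - f u) / (v - u) * u) * hab

lemma chordLine_mono {f : ℝ → ℝ} {u v : ℝ} (huv : u < v) (h : f u ≤ f v) :
    Monotone (chordLine f u v) := by
  intro x y hxy
  have : 0 ≤ (f v - f u) / (v - u) := div_nonneg (by linarith) (by linarith)
  simp only [chordLine]
  have := mul_le_mul_of_nonneg_left (sub_le_sub_right hxy u) this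
  linarith

lemma nodes_le {t : ℕ → ℝ} {N : ℕ} (ht : ∀ j < N, t j < t (j + 1)) {i j : ℕ} (hij : i ≤ j)
    (hj : j ≤ N) : t i ≤ t j := by
  induction j, hij using Nat.le_induction with
  | base => exact le_rfl
  | succ j _ ih => exact (ih (by omega)).trans (ht j (by omega)).le

lemma exists_node_index {t : ℕ → ℝ} {N : ℕ} (hN : 0 < N) :
    ∃ idx : ℝ → ℕ, MonotoneOn idx (Icc (t 0) (t N)) ∧
      ∀ y ∈ Icc (t 0) (t N), idx y < N ∧ y ∈ Icc (t (idx y)) (t (idx y + 1)) := by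
  have hmem : ∀ y ∈ Icc (t 0) (t N), N - 1 ∈ {i | y ≤ t (i + 1)} := by
    intro y hy
    simpa [Nat.sub_add_cancel hN] using hy.2
  refine ⟨fun y => sInf {i | y ≤ t (i + 1)}, ?_, ?_⟩
  · intro x hx y hy hxy
    have : sInf {i | y ≤ t (i + 1)} ∈ {i | y ≤ t (i + 1)} := Nat.sInf_mem ⟨_, hmem y hy⟩
    exact Nat.sInf_le (le_trans hxy this)
  · intro y hy
    refine ⟨?_, ?_, Nat.sInf_mem (s := {i | y ≤ t (i + 1)}) ⟨_, hmem y hy⟩⟩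
    · exact (Nat.sInf_le (hmem y hy)).trans_lt (Nat.sub_lt hN one_pos)
    · rcases Nat.eq_zero_or_pos (sInf {i | y ≤ t (i + 1)}) with h | h
      · simpa only [h] using hy.1
      · have h1 := Nat.notMem_of_lt_sInf (Nat.sub_lt h one_pos)
        rw [mem_ofPred_eq, not_le, Nat.sub_add_cancel (show 1 ≤ _ from h)] at h1
        exact h1.le

/-- `g` is affine on each of at most `N` intervals partitioning `I`. -/
def AffineOnFibers (g : ℝ → ℝ) (I : Set ℝ) (N : ℕ) : Prop :=
  ∃ idx : ℝ → ℕ, (∀ y ∈ I, idx y < N) ∧ (∀ i, (I ∩ idx ⁻¹' {i}).OrdConnected) ∧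
    ∀ i, ∃ α β : ℝ, ∀ y ∈ I, idx y = i → g y = α * y + β

/-- Every interval of length `ℓ` contains at most `ν * ℓ + 1` of the points `y i`, `i ∈ S`. -/
def CountBound {ι : Type} (S : Finset ι) (y : ι → ℝ) (ν : ℝ) : Prop :=
  ∀ u v : ℝ, u ≤ v → ((S.filter fun i => y i ∈ Icc u v).card : ℝ) ≤ ν * (v - u) + 1

lemma sum_le_of_card_le {ι : Type} (T : Finset ι) (e : ι → ℝ) {h ν B w : ℝ} (hν : 0 ≤ ν)
    (hh : 0 ≤ h) (heB : ∀ i ∈ T, h * e i ≤ B) (hew : ∀ i ∈ T, e i ≤ w)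
    (hcard : (T.card : ℝ) ≤ ν * h + 1) (hB : 0 ≤ B) (hw : 0 ≤ w) :
    ∑ i ∈ T, e i ≤ ν * B + w := by
  have hpos : 0 < ν * h + 1 := by positivity
  have h1 : (ν * h + 1) * ∑ i ∈ T, e i ≤ T.card * (ν * B + w) := by
    rw [Finset.mul_sum, ← nsmul_eq_mul]
    refine Finset.sum_le_card_nsmul _ _ _ fun i hi => ?_
    nlinarith [heB i hi, hew i hi, mul_le_mul_of_nonneg_left (heB i hi) hν]
  have h2 : (T.card : ℝ) * (ν * B + w) ≤ (ν * h + 1) * (ν * B + w) :=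
    mul_le_mul_of_nonneg_right hcard (by positivity)
  exact le_of_mul_le_mul_left (h1.trans h2) hpos

lemma exists_convex_interpolant {f : ℝ → ℝ} {t : ℕ → ℝ} {N : ℕ} (hN : 0 < N)
    (ht : ∀ j < N, t j < t (j + 1)) (hconv : ConvexOn ℝ (Icc (t 0) (t N)) f)
    (hmono : MonotoneOn f (Icc (t 0) (t N))) :
    ∃ g : ℝ → ℝ, Continuous g ∧ Monotone g ∧ ConvexOn ℝ univ g ∧
      ∀ j < N, ∀ x ∈ Icc (t j) (t (j + 1)), g x = chordLine f (t j) (t (j + 1)) x := by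
  have hmem : ∀ j ≤ N, t j ∈ Icc (t 0) (t N) := fun j hj =>
    ⟨nodes_le ht (Nat.zero_le j) hj, nodes_le ht hj le_rfl⟩
  have hne : (Finset.range N).Nonempty := ⟨0, by simpa using hN⟩
  refine ⟨fun x => (Finset.range N).sup' hne fun j => chordLine f (t j) (t (j + 1)) x,
    ?_, ?_, ?_, ?_⟩
  · refine Continuous.finset_sup'_apply hne fun j _ => ?_
    unfold chordLine
    fun_prop
  · intro x y hxy
    refine Finset.sup'_mono_fun fun j hj => ?_
    have hj := Finset.mem_range.1 hj
    exact chordLine_mono (ht j hj)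
      (hmono (hmem j hj.le) (hmem (j + 1) hj) (ht j hj).le) hxy
  · refine ⟨convex_univ, fun x _ y _ a b ha hb hab => ?_⟩
    refine Finset.sup'_le _ _ fun j hj => ?_
    simp only [smul_eq_mul]
    rw [chordLine_combo _ _ _ _ _ _ _ hab]
    exact add_le_add
      (mul_le_mul_of_nonneg_left
        (Finset.le_sup' (fun j => chordLine f (t j) (t (j + 1)) x) hj) ha)
      (mul_le_mul_of_nonneg_left
        (Finset.le_sup' (fun j => chordLine f (t j) (t (j + 1)) y) hj) hb)
  · intro j hj x hx
    refine le_antisymm (Finset.sup'_le _ _ fun i hi => ?_)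
      (Finset.le_sup' (fun j => chordLine f (t j) (t (j + 1)) x) (Finset.mem_range.2 hj))
    have hi := Finset.mem_range.1 hi
    rcases eq_or_ne i j with rfl | hij
    · exact le_rfl
    have key : ∀ l ≤ N, (l ≤ i ∨ i + 1 ≤ l) → chordLine f (t i) (t (i + 1)) (t l) ≤ f (t l) := by
      intro l hl h
      rcases h with h | h
      · exact chordLine_le_of_le hconv (hmem _ hi) (hmem _ hl) (ht i hi) (nodes_le ht h hi.le)
      · exact chordLine_le_of_ge hconv (hmem _ hi.le) (hmem _ hl) (ht i hi) (nodes_le ht h hl)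
    have k1 := key j hj.le (by omega)
    have k2 := key (j + 1) hj (by omega)
    have hd : 0 < t (j + 1) - t j := sub_pos.2 (ht j hj)
    have hx1 : x = (t (j + 1) - x) / (t (j + 1) - t j) * t j
        + (x - t j) / (t (j + 1) - t j) * t (j + 1) := by
      field_simp
      ring
    have hab : (t (j + 1) - x) / (t (j + 1) - t j) + (x - t j) / (t (j + 1) - t j) = 1 := by
      field_simp
      ring
    rw [hx1, chordLine_combo _ _ _ _ _ _ _ hab, chordLine_combo _ _ _ _ _ _ _ hab,
      chordLine_left f (t j), chordLine_right f (ht j hj)]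
    exact add_le_add
      (mul_le_mul_of_nonneg_left k1 (div_nonneg (by linarith [hx.2]) hd.le))
      (mul_le_mul_of_nonneg_left k2 (div_nonneg (by linarith [hx.1]) hd.le))

/-- The interpolant of a monotone convex function at given nodes, with its discrete error. -/
lemma exists_interpolant_error {f : ℝ → ℝ} {t B : ℕ → ℝ} {N : ℕ} (hN : 0 < N)
    (ht : ∀ j < N, t j < t (j + 1)) (hconv : ConvexOn ℝ (Icc (t 0) (t N)) f)
    (hmono : MonotoneOn f (Icc (t 0) (t N)))
    (hB : ∀ j < N, ∀ x ∈ Icc (t j) (t (j + 1)),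
      (t (j + 1) - t j) * (chordLine f (t j) (t (j + 1)) x - f x) ≤ B j) :
    ∃ g : ℝ → ℝ, Continuous g ∧ Monotone g ∧ ConvexOn ℝ univ g ∧
      g (t 0) = f (t 0) ∧ g (t N) = f (t N) ∧ AffineOnFibers g (Icc (t 0) (t N)) N ∧
      ∀ (ι : Type) (S : Finset ι) (y : ι → ℝ) (ν : ℝ), 0 ≤ ν → CountBound S y ν →
        (∀ i ∈ S, y i ∈ Icc (t 0) (t N)) →
        ∑ i ∈ S, |f (y i) - g (y i)| ≤ ν * ∑ j ∈ Finset.range N, B j + (f (t N) - f (t 0)) := by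
  obtain ⟨g, hgc, hgm, hgv, hg⟩ := exists_convex_interpolant hN ht hconv hmono
  obtain ⟨idx, hidx, hidx'⟩ := exists_node_index (t := t) hN
  have hmem : ∀ j ≤ N, t j ∈ Icc (t 0) (t N) := fun j hj =>
    ⟨nodes_le ht (Nat.zero_le j) hj, nodes_le ht hj le_rfl⟩
  refine ⟨g, hgc, hgm, hgv, ?_, ?_, ⟨idx, fun y hy => (hidx' y hy).1, ?_, ?_⟩, ?_⟩
  · rw [hg 0 hN _ ⟨le_rfl, (ht 0 hN).le⟩, chordLine_left]
  · obtain ⟨M, rfl⟩ : ∃ M, N = M + 1 := ⟨N - 1, by omega⟩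
    rw [hg M (by omega) _ ⟨(ht M (by omega)).le, le_rfl⟩, chordLine_right f (ht M (by omega))]
  · intro i
    refine ⟨fun x hx z hz y hy => ?_⟩
    have hyI : y ∈ Icc (t 0) (t N) := ⟨hx.1.1.trans hy.1, hy.2.trans hz.1.2⟩
    refine ⟨hyI, le_antisymm ?_ ?_⟩
    · exact (hidx hyI hz.1 hy.2).trans_eq hz.2
    · exact (Eq.symm hx.2).le.trans (hidx hx.1 hyI hy.1)
  · intro i
    refine ⟨(f (t (i + 1)) - f (t i)) / (t (i + 1) - t i),
      f (t i) - (f (t (i + 1)) - f (t i)) / (t (i + 1) - t i) * t i, ?_⟩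
    rintro y hy rfl
    obtain ⟨h1, h2⟩ := hidx' y hy
    rw [hg _ h1 y h2, chordLine]
    ring
  · intro ι S y ν hν hcount hyI
    have hsplit : ∑ i ∈ S, |f (y i) - g (y i)| =
        ∑ j ∈ Finset.range N, ∑ i ∈ S with idx (y i) = j, |f (y i) - g (y i)| := by
      refine (Finset.sum_fiberwise_of_maps_to (fun i hi => ?_) _).symm
      exact Finset.mem_range.2 (hidx' _ (hyI i hi)).1
    have htel : f (t N) - f (t 0) = ∑ j ∈ Finset.range N, (f (t (j + 1)) - f (t j)) :=
      (Finset.sum_range_sub (fun j => f (t j)) N).symm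
    rw [hsplit, htel, Finset.mul_sum, ← Finset.sum_add_distrib]
    refine Finset.sum_le_sum fun j hj => ?_
    have hj := Finset.mem_range.1 hj
    have hmm := hmono (hmem j hj.le) (hmem (j + 1) hj) (ht j hj).le
    have hB0 : 0 ≤ B j := by
      have := hB j hj (t j) ⟨le_rfl, (ht j hj).le⟩
      simpa [chordLine_left] using this
    have hin : ∀ i ∈ S.filter (fun i => idx (y i) = j), y i ∈ Icc (t j) (t (j + 1)) := by
      intro i hi
      obtain ⟨hiS, rfl⟩ := Finset.mem_filter.1 hi
      exact (hidx' _ (hyI i hiS)).2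
    have habs : ∀ i ∈ S.filter (fun i => idx (y i) = j),
        |f (y i) - g (y i)| = chordLine f (t j) (t (j + 1)) (y i) - f (y i) := by
      intro i hi
      rw [hg j hj _ (hin i hi), abs_sub_comm, abs_of_nonneg]
      exact sub_nonneg.2 (le_chordLine hconv (hmem j hj.le) (hmem (j + 1) hj) (ht j hj) (hin i hi))
    refine sum_le_of_card_le _ _ (h := t (j + 1) - t j) hν (sub_pos.2 (ht j hj)).le
      (fun i hi => ?_) (fun i hi => ?_) ?_ hB0 (sub_nonneg.2 hmm)
    · rw [habs i hi]
      exact hB j hj _ (hin i hi)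
    · rw [habs i hi]
      have h1 := chordLine_mono (ht j hj) hmm (hin i hi).2
      rw [chordLine_right f (ht j hj)] at h1
      have hyi := hin i hi
      have h2 : f (t j) ≤ f (y i) := hmono (hmem j hj.le)
        (hyI i (Finset.mem_filter.1 hi).1) hyi.1
      linarith
    · refine le_trans ?_ (hcount _ _ (ht j hj).le)
      exact_mod_cast Finset.card_le_card fun i hi =>
        Finset.mem_filter.2 ⟨(Finset.mem_filter.1 hi).1, hin i hi⟩

lemma exists_subgradient {f : ℝ → ℝ} {c d u : ℝ} (hf : ConvexOn ℝ (Icc c d) f)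
    (hu : u ∈ Ioo c d) : ∃ G : ℝ, ∀ y ∈ Icc c d, f u + G * (y - u) ≤ f y := by
  have hui : u ∈ interior (Icc c d) := by rwa [interior_Icc]
  refine ⟨derivWithin f (Ioi u) u, fun y hy => ?_⟩
  rcases lt_trichotomy y u with h | rfl | h
  · have h1 := (hf.slope_le_leftDeriv_of_mem_interior hy hui h).trans
      (hf.leftDeriv_le_rightDeriv_of_mem_interior hui)
    rw [slope_def_field, div_le_iff₀ (by linarith)] at h1
    linarith
  · simp
  · have h1 := hf.rightDeriv_le_slope_of_mem_interior hui hy h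
    rw [slope_def_field, le_div_iff₀ (by linarith)] at h1
    linarith

lemma exists_touching_point {f : ℝ → ℝ} {c d : ℝ} (hcd : c ≤ d) (hf : ContinuousOn f (Icc c d))
    (Δ : ℝ) : ∃ z ∈ Icc c d, ∀ y ∈ Icc c d, f z + Δ * (y - z) ≤ f y := by
  obtain ⟨z, hz, hmin⟩ := isCompact_Icc.exists_isMinOn (nonempty_Icc.2 hcd)
    (f := fun x => f x - Δ * x) (by fun_prop)
  refine ⟨z, hz, fun y hy => ?_⟩
  have : f z - Δ * z ≤ f y - Δ * y := hmin hy
  linarith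

lemma chord_error_of_subgradients {f : ℝ → ℝ} {u v x Gu Gv : ℝ} (huv : u < v)
    (hx : x ∈ Icc u v) (h1 : f u + Gu * (x - u) ≤ f x) (h2 : f u + Gu * (v - u) ≤ f v)
    (h3 : f v + Gv * (x - v) ≤ f x) (h4 : f v + Gv * (u - v) ≤ f u) :
    (v - u) * (chordLine f u v x - f x) ≤ (v - u) ^ 2 * (Gv - Gu) / 2 := by
  rw [mul_chordLine_sub f huv]
  have hh : 0 ≤ v - u := by linarith
  have e1 : (f v - f u) * (x - u) - (v - u) * (f x - f u)
      ≤ (v - u) * (f v - f u - (v - u) * Gu) := by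
    have a1 := mul_le_mul_of_nonneg_left h1 hh
    have a2 : (x - u) * (f v - f u - (v - u) * Gu) ≤ (v - u) * (f v - f u - (v - u) * Gu) :=
      mul_le_mul_of_nonneg_right (by linarith [hx.2]) (by linarith)
    nlinarith
  have e2 : (f v - f u) * (x - u) - (v - u) * (f x - f u)
      ≤ (v - u) * ((v - u) * Gv - (f v - f u)) := by
    have a1 := mul_le_mul_of_nonneg_left h3 hh
    have a2 : (v - x) * ((v - u) * Gv - (f v - f u)) ≤ (v - u) * ((v - u) * Gv - (f v - f u)) :=
      mul_le_mul_of_nonneg_right (by linarith [hx.1]) (by linarith)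
    nlinarith
  nlinarith

lemma chord_error_of_inverse_subgradients {f : ℝ → ℝ} {u v x Au Av : ℝ} (huv : u < v)
    (hx : x ∈ Icc u v) (hfu : f u < f v)
    (h1 : x - u ≤ Au * (f x - f u)) (h2 : v - u ≤ Au * (f v - f u))
    (h3 : x - v ≤ Av * (f x - f v)) (h4 : u - v ≤ Av * (f u - f v)) (hfx' : f u ≤ f x) :
    (v - u) * (chordLine f u v x - f x) ≤ (f v - f u) ^ 2 * (Au - Av) / 2 := by
  rw [mul_chordLine_sub f huv]
  have hh : 0 ≤ v - u := by linarith
  have hw : 0 < f v - f u := by linarith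
  have hA : 0 < Au := by
    by_contra! h
    nlinarith
  have e1 : (f v - f u) * (x - u) - (v - u) * (f x - f u)
      ≤ (f v - f u) * ((f v - f u) * Au - (v - u)) := by
    have a1 := mul_le_mul_of_nonneg_left h1 hh
    have a2 : (x - u) * ((f v - f u) * Au - (v - u)) ≤ (v - u) * ((f v - f u) * Au - (v - u)) :=
      mul_le_mul_of_nonneg_right (by linarith [hx.2]) (by linarith)
    have a3 : (v - u) * ((f v - f u) * Au - (v - u))
        ≤ (Au * (f v - f u)) * ((f v - f u) * Au - (v - u)) :=
      mul_le_mul_of_nonneg_right h2 (by linarith)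
    refine le_of_mul_le_mul_left ?_ hA
    nlinarith
  have e2 : (f v - f u) * (x - u) - (v - u) * (f x - f u)
      ≤ (f v - f u) * ((v - u) - (f v - f u) * Av) := by
    have a1 := mul_le_mul_of_nonneg_left h3 hw.le
    have a2 : (f v - f x) * ((v - u) - (f v - f u) * Av)
        ≤ (f v - f u) * ((v - u) - (f v - f u) * Av) :=
      mul_le_mul_of_nonneg_right (by linarith) (by linarith)
    nlinarith
  nlinarith

/-- Equispaced nodes on a part of the interval where the slopes vary between `p` and `q`. -/
lemma exists_equispaced_nodes {f : ℝ → ℝ} {c d z p q : ℝ} {m : ℕ} (hm : 0 < m)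
    (hf : ConvexOn ℝ (Icc c d) f) (hcz : c < z) (hzd : z ≤ d)
    (hp : ∀ y ∈ Icc c d, f c + p * (y - c) ≤ f y)
    (hq : ∀ y ∈ Icc c d, f z + q * (y - z) ≤ f y) :
    ∃ t B : ℕ → ℝ, t 0 = c ∧ t m = z ∧ (∀ j < m, t j < t (j + 1)) ∧
      (∀ j < m, ∀ x ∈ Icc (t j) (t (j + 1)),
        (t (j + 1) - t j) * (chordLine f (t j) (t (j + 1)) x - f x) ≤ B j) ∧
      ∑ j ∈ Finset.range m, B j = ((z - c) / m) ^ 2 * (q - p) / 2 := by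
  have hm' : (0 : ℝ) < m := by exact_mod_cast hm
  set δ := (z - c) / m with hδ
  have hδ0 : 0 < δ := div_pos (by linarith) hm'
  have hmδ : m * δ = z - c := by rw [hδ]; field_simp
  set t : ℕ → ℝ := fun j => c + j * δ with ht
  have hstep : ∀ j, t (j + 1) - t j = δ := by intro j; simp only [ht]; push_cast; ring
  have htlt : ∀ j < m, t j < t (j + 1) := fun j _ => by linarith [hstep j]
  have ht0 : t 0 = c := by simp [ht]
  have htm : t m = z := by simp only [ht]; linarith
  have htmem : ∀ j ≤ m, t j ∈ Icc c z := fun j hj => by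
    rw [← ht0, ← htm]
    exact ⟨nodes_le htlt (Nat.zero_le j) hj, nodes_le htlt hj le_rfl⟩
  have hG : ∀ j : ℕ, ∃ G : ℝ, (j ≤ m → ∀ y ∈ Icc c d, f (t j) + G * (y - t j) ≤ f y) ∧
      (j = 0 → G = p) ∧ (j = m → G = q) := by
    intro j
    rcases Nat.eq_zero_or_pos j with rfl | hj
    · exact ⟨p, fun _ => by rwa [ht0], fun _ => rfl, fun h => absurd h hm.ne⟩
    rcases lt_trichotomy j m with h | rfl | h
    · have h1 : t j ∈ Ioo c d := by
        refine ⟨?_, ?_⟩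
        · have := htlt 0 hm
          have := nodes_le htlt (i := 0 + 1) hj h.le
          linarith
        · have := htlt j h
          have := (htmem (j + 1) h).2
          linarith
      obtain ⟨G, hG⟩ := exists_subgradient hf h1
      exact ⟨G, fun _ => hG, fun h => absurd h hj.ne', fun h' => absurd h' h.ne⟩
    · exact ⟨q, fun _ => by rwa [htm], fun h => absurd h hj.ne', fun _ => rfl⟩
    · exact ⟨0, fun h' => absurd h' (not_le.2 h), fun h => absurd h hj.ne',
        fun h' => absurd h' h.ne'⟩
  choose G hG hG0 hGm using hG
  refine ⟨t, fun j => δ ^ 2 * (G (j + 1) - G j) / 2, ht0, htm, htlt, fun j hj x hx => ?_, ?_⟩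
  · have hmem : ∀ i ≤ m, t i ∈ Icc c d := fun i hi => ⟨(htmem i hi).1, (htmem i hi).2.trans hzd⟩
    have hxI : x ∈ Icc c d := ⟨(hmem j hj.le).1.trans hx.1, hx.2.trans (hmem (j + 1) hj).2⟩
    have := chord_error_of_subgradients (htlt j hj) hx (hG j hj.le x hxI)
      (hG j hj.le _ (hmem (j + 1) hj)) (hG (j + 1) hj x hxI) (hG (j + 1) hj _ (hmem j hj.le))
    rwa [hstep] at this ⊢
  · rw [← Finset.sum_div, ← Finset.mul_sum, Finset.sum_range_sub, hG0 0 rfl, hGm m rfl]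

/-- Nodes with equispaced values, on a part of the interval where the inverse slopes vary
between `r` and `s`. -/
lemma exists_equivalued_nodes {f : ℝ → ℝ} {c d z r s : ℝ} {m : ℕ} (hm : 0 < m)
    (hcont : ContinuousOn f (Icc c d))
    (hf : ConvexOn ℝ (Icc c d) f) (hmono : MonotoneOn f (Icc c d)) (hcz : c ≤ z) (hzd : z < d)
    (hfz : f z < f d) (hpos : ∀ y ∈ Ioc z d, f z < f y)
    (hs : ∀ y ∈ Icc c d, y - z ≤ s * (f y - f z))
    (hr : ∀ y ∈ Icc c d, y - d ≤ r * (f y - f d)) :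
    ∃ t B : ℕ → ℝ, t 0 = z ∧ t m = d ∧ (∀ j < m, t j < t (j + 1)) ∧
      (∀ j < m, ∀ x ∈ Icc (t j) (t (j + 1)),
        (t (j + 1) - t j) * (chordLine f (t j) (t (j + 1)) x - f x) ≤ B j) ∧
      ∑ j ∈ Finset.range m, B j = ((f d - f z) / m) ^ 2 * (s - r) / 2 := by
  have hm' : (0 : ℝ) < m := by exact_mod_cast hm
  set δ := (f d - f z) / m with hδ
  have hδ0 : 0 < δ := div_pos (by linarith) hm'
  have hmδ : m * δ = f d - f z := by rw [hδ]; field_simp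
  have hzsub : Icc z d ⊆ Icc c d := Icc_subset_Icc_left hcz
  have hzI : z ∈ Icc c d := ⟨hcz, hzd.le⟩
  have hdI : d ∈ Icc c d := ⟨hcz.trans hzd.le, le_rfl⟩
  have hstrict : ∀ x ∈ Icc z d, ∀ y ∈ Icc z d, x < y → f x < f y := by
    intro x hx y hy hxy
    have h1 := hf.chord_mul_le hzI (hzsub hy) hx.1 hxy.le
    have h2 := hpos y ⟨hx.1.trans_lt hxy, hy.2⟩
    have h3 : 0 < y - z := by linarith [hx.1]
    nlinarith
  have hex : ∀ j : ℕ, ∃ v, j ≤ m → v ∈ Icc z d ∧ f v = f z + j * δ := by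
    intro j
    by_cases hj : j ≤ m
    · have hj' : (j : ℝ) ≤ m := by exact_mod_cast hj
      have h0 : (0 : ℝ) ≤ j := by positivity
      obtain ⟨v, hv, hv'⟩ := intermediate_value_Icc hzd.le (hcont.mono hzsub)
        (show f z + j * δ ∈ Icc (f z) (f d) from
          ⟨by nlinarith, by nlinarith⟩)
      exact ⟨v, fun _ => ⟨hv, hv'⟩⟩
    · exact ⟨0, fun h => absurd h hj⟩
  choose t ht using hex
  have htmem : ∀ j ≤ m, t j ∈ Icc z d := fun j hj => (ht j hj).1
  have htv : ∀ j ≤ m, f (t j) = f z + j * δ := fun j hj => (ht j hj).2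
  have hmem : ∀ j ≤ m, t j ∈ Icc c d := fun j hj => hzsub (htmem j hj)
  have hinj : ∀ x ∈ Icc z d, ∀ y ∈ Icc z d, f x = f y → x = y := by
    intro x hx y hy hxy
    rcases lt_trichotomy x y with h | h | h
    · exact absurd hxy (hstrict x hx y hy h).ne
    · exact h
    · exact absurd hxy (hstrict y hy x hx h).ne'
  have ht0 : t 0 = z := hinj _ (htmem 0 hm.le) _ ⟨le_rfl, hzd.le⟩ (by rw [htv 0 hm.le]; simp)
  have htm : t m = d := hinj _ (htmem m le_rfl) _ ⟨hzd.le, le_rfl⟩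
    (by rw [htv m le_rfl, hmδ]; ring)
  have hstep : ∀ j < m, f (t (j + 1)) - f (t j) = δ := by
    intro j hj
    rw [htv _ hj, htv _ hj.le]; push_cast; ring
  have htlt : ∀ j < m, t j < t (j + 1) := by
    intro j hj
    by_contra! h
    have := hmono (hmem _ hj) (hmem _ hj.le) h
    linarith [hstep j hj]
  have hA : ∀ j : ℕ, ∃ A : ℝ, (j ≤ m → ∀ y ∈ Icc c d, y - t j ≤ A * (f y - f (t j))) ∧
      (j = 0 → A = s) ∧ (j = m → A = r) := by
    intro j
    rcases Nat.eq_zero_or_pos j with rfl | hj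
    · exact ⟨s, fun _ => by rwa [ht0], fun _ => rfl, fun h => absurd h hm.ne⟩
    rcases lt_trichotomy j m with h | rfl | h
    · have h0 : z < t j := by
        have := htlt 0 hm
        have := nodes_le htlt (i := 0 + 1) hj h.le
        linarith
      have h1 : t j ∈ Ioo c d := by
        refine ⟨by linarith, ?_⟩
        have := htlt j h
        have := (htmem (j + 1) h).2
        linarith
      obtain ⟨G, hG⟩ := exists_subgradient hf h1
      have hGpos : 0 < G := by
        by_contra! hneg
        have h2 := hG z hzI
        have h3 := hpos (t j) ⟨h0, h1.2.le⟩
        nlinarith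
      refine ⟨1 / G, fun _ y hy => ?_, fun h => absurd h hj.ne', fun h' => absurd h' h.ne⟩
      rw [one_div_mul_eq_div, le_div_iff₀ hGpos]
      linarith [hG y hy]
    · exact ⟨r, fun _ => by rwa [htm], fun h => absurd h hj.ne', fun _ => rfl⟩
    · exact ⟨0, fun h' => absurd h' (not_le.2 h), fun h => absurd h hj.ne',
        fun h' => absurd h' h.ne'⟩
  choose A hA hA0 hAm using hA
  refine ⟨t, fun j => δ ^ 2 * (A j - A (j + 1)) / 2, ht0, htm, htlt, fun j hj x hx => ?_, ?_⟩
  · have hxI : x ∈ Icc c d := ⟨(hmem j hj.le).1.trans hx.1, hx.2.trans (hmem (j + 1) hj).2⟩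
    have := chord_error_of_inverse_subgradients (htlt j hj) hx
      (by linarith [hstep j hj]) (hA j hj.le x hxI) (hA j hj.le _ (hmem (j + 1) hj))
      (hA (j + 1) hj x hxI) (hA (j + 1) hj _ (hmem j hj.le)) (hmono (hmem _ hj.le) hxI hx.1)
    rwa [hstep j hj] at this
  · rw [← Finset.sum_div, ← Finset.mul_sum, Finset.sum_range_sub', hA0 0 rfl, hAm m rfl]

/-- Nodes on adjacent intervals can be concatenated. -/
lemma exists_concat_nodes {E : ℝ → ℝ → ℝ → Prop} {c z d : ℝ} {m : ℕ} {t₁ B₁ t₂ B₂ : ℕ → ℝ}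
    (h1c : t₁ 0 = c) (h1z : t₁ m = z) (h2z : t₂ 0 = z) (h2d : t₂ m = d)
    (h1 : ∀ j < m, t₁ j < t₁ (j + 1)) (h2 : ∀ j < m, t₂ j < t₂ (j + 1))
    (hE1 : ∀ j < m, E (t₁ j) (t₁ (j + 1)) (B₁ j)) (hE2 : ∀ j < m, E (t₂ j) (t₂ (j + 1)) (B₂ j)) :
    ∃ t B : ℕ → ℝ, t 0 = c ∧ t (m + m) = d ∧ (∀ j < m + m, t j < t (j + 1)) ∧
      (∀ j < m + m, E (t j) (t (j + 1)) (B j)) ∧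
      ∑ j ∈ Finset.range (m + m), B j
        = ∑ j ∈ Finset.range m, B₁ j + ∑ j ∈ Finset.range m, B₂ j := by
  set t : ℕ → ℝ := fun j => if j ≤ m then t₁ j else t₂ (j - m) with ht
  set B : ℕ → ℝ := fun j => if j < m then B₁ j else B₂ (j - m) with hB
  have htl : ∀ j ≤ m, t j = t₁ j := fun j hj => if_pos hj
  have htr : ∀ j, t (m + j) = t₂ j := by
    intro j
    rcases Nat.eq_zero_or_pos j with rfl | hj
    · rw [add_zero, htl m le_rfl, h1z, h2z]
    · simp [ht, hj.ne']
  have hBl : ∀ j < m, B j = B₁ j := fun j hj => if_pos hj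
  have hBr : ∀ j, B (m + j) = B₂ j := fun j => by simp [hB]
  have key : ∀ j < m + m, t j < t (j + 1) ∧ E (t j) (t (j + 1)) (B j) := by
    intro j hj
    rcases lt_or_ge j m with h | h
    · rw [htl j h.le, htl (j + 1) h, hBl j h]
      exact ⟨h1 j h, hE1 j h⟩
    · obtain ⟨i, rfl⟩ := Nat.exists_eq_add_of_le h
      rw [htr, add_assoc, htr, hBr]
      exact ⟨h2 i (by omega), hE2 i (by omega)⟩
  refine ⟨t, B, ?_, ?_, fun j hj => (key j hj).1, fun j hj => (key j hj).2, ?_⟩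
  · rw [htl 0 (Nat.zero_le m), h1c]
  · rw [htr, h2d]
  · rw [Finset.sum_range_add]
    congr 1
    · exact Finset.sum_congr rfl fun j hj => hBl j (Finset.mem_range.1 hj)
    · exact Finset.sum_congr rfl fun j _ => hBr j

/-- `f` has a monotone convex-or-concave approximation on `[c, d]`, with the same values at the
endpoints and at most `N` affine pieces, whose discrete error is controlled by `K`. -/
def HasApprox (f : ℝ → ℝ) (c d : ℝ) (N : ℕ) (K : ℝ) : Prop :=
  ∃ g : ℝ → ℝ, ContinuousOn g (Icc c d) ∧ (MonotoneOn g (Icc c d) ∨ AntitoneOn g (Icc c d)) ∧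
    (ConvexOn ℝ (Icc c d) g ∨ ConcaveOn ℝ (Icc c d) g) ∧ g c = f c ∧ g d = f d ∧
    AffineOnFibers g (Icc c d) N ∧
    ∀ (ι : Type) (S : Finset ι) (y : ι → ℝ) (ν : ℝ), 0 ≤ ν → CountBound S y ν →
      (∀ i ∈ S, y i ∈ Icc c d) → ∑ i ∈ S, |f (y i) - g (y i)| ≤ ν * K + |f d - f c|

lemma HasApprox.of_neg {f : ℝ → ℝ} {c d K : ℝ} {N : ℕ} (h : HasApprox (fun x => -f x) c d N K) :
    HasApprox f c d N K := by
  obtain ⟨g, hc, hm, hv, h1, h2, ⟨idx, i1, i2, i3⟩, hE⟩ := h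
  refine ⟨fun x => -g x, hc.neg, ?_, ?_, by simp [h1], by simp [h2], ⟨idx, i1, i2, fun i => ?_⟩, ?_⟩
  · exact hm.symm.imp (fun h => h.neg) (fun h => h.neg)
  · exact hv.symm.imp (fun h => h.neg) (fun h => h.neg)
  · obtain ⟨α, β, h⟩ := i3 i
    exact ⟨-α, -β, fun y hy hi => by simp only [h y hy hi]; ring⟩
  · intro ι S y ν hν hcount hy
    have := hE ι S y ν hν hcount hy
    have e : |-f d - -f c| = |f d - f c| := by rw [← abs_neg]; congr 1; ring
    rw [e] at this
    refine le_trans (Finset.sum_le_sum fun i _ => ?_) this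
    rw [← abs_neg]
    exact le_of_eq (congrArg abs (by ring))

lemma HasApprox.of_reflect {f : ℝ → ℝ} {c d K : ℝ} {N : ℕ}
    (h : HasApprox (fun x => f (-x)) (-d) (-c) N K) : HasApprox f c d N K := by
  obtain ⟨g, hc, hm, hv, h1, h2, ⟨idx, i1, i2, i3⟩, hE⟩ := h
  have hmaps : ∀ x ∈ Icc c d, -x ∈ Icc (-d) (-c) := fun x hx =>
    ⟨neg_le_neg hx.2, neg_le_neg hx.1⟩
  simp only [neg_neg] at h1 h2 hE
  refine ⟨fun x => g (-x), hc.comp continuous_neg.continuousOn hmaps, ?_, ?_, h2, h1,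
    ⟨fun x => idx (-x), fun y hy => i1 _ (hmaps y hy), fun i => ⟨fun x hx z hz y hy => ?_⟩,
      fun i => ?_⟩, ?_⟩
  · refine hm.symm.imp (fun h x hx y hy hxy => ?_) (fun h x hx y hy hxy => ?_)
    · exact h (hmaps y hy) (hmaps x hx) (neg_le_neg hxy)
    · exact h (hmaps y hy) (hmaps x hx) (neg_le_neg hxy)
  · refine hv.imp (fun h => ⟨convex_Icc _ _, fun x hx y hy a b ha hb hab => ?_⟩)
      (fun h => ⟨convex_Icc _ _, fun x hx y hy a b ha hb hab => ?_⟩)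
    · have := h.2 (hmaps x hx) (hmaps y hy) ha hb hab
      convert this using 2
      simp only [smul_eq_mul]; ring
    · have := h.2 (hmaps x hx) (hmaps y hy) ha hb hab
      convert this using 2
      simp only [smul_eq_mul]; ring
  · have := (i2 i).out ⟨hmaps z hz.1, hz.2⟩ ⟨hmaps x hx.1, hx.2⟩
      (show -y ∈ Icc (-z) (-x) from ⟨neg_le_neg hy.2, neg_le_neg hy.1⟩)
    exact ⟨⟨hx.1.1.trans hy.1, hy.2.trans hz.1.2⟩, this.2⟩
  · obtain ⟨α, β, h⟩ := i3 i
    exact ⟨-α, β, fun y hy hi => by simp only [h _ (hmaps y hy) hi]; ring⟩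
  · intro ι S y ν hν hcount hy
    have := hE ι S (fun i => -y i) ν hν ?_ (fun i hi => hmaps _ (hy i hi))
    · simpa [abs_sub_comm (f c)] using this
    · intro u v huv
      have := hcount (-v) (-u) (by linarith)
      have e : -u - -v = v - u := by ring
      rw [e] at this
      refine le_trans ?_ this
      refine Nat.cast_le.2 (Finset.card_le_card fun i hi => ?_)
      obtain ⟨hiS, h1, h2⟩ := Finset.mem_filter.1 hi
      exact Finset.mem_filter.2 ⟨hiS, by linarith, by linarith⟩

lemma hasApprox_of_affine {f : ℝ → ℝ} {c d α β K : ℝ} {N : ℕ} (hN : 0 < N) (hcd : c ≤ d)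
    (hK : 0 ≤ K) (hf : ∀ x ∈ Icc c d, f x = α * x + β) : HasApprox f c d N K := by
  have hmono : MonotoneOn (fun x => α * x + β) (Icc c d) ∨
      AntitoneOn (fun x => α * x + β) (Icc c d) := by
    rcases le_total 0 α with h | h
    · exact Or.inl fun x _ y _ hxy => by
        simpa using mul_le_mul_of_nonneg_left hxy h
    · exact Or.inr fun x _ y _ hxy => by
        simpa using mul_le_mul_of_nonpos_left hxy h
  refine ⟨fun x => α * x + β, by fun_prop, hmono, Or.inl ⟨convex_Icc _ _, ?_⟩,
    (hf c ⟨le_rfl, hcd⟩).symm, (hf d ⟨hcd, le_rfl⟩).symm,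
    ⟨fun _ => 0, fun _ _ => hN, fun i => ?_, fun _ => ⟨α, β, fun _ _ _ => rfl⟩⟩, ?_⟩
  · intro x _ y _ a b _ _ hab
    simp only [smul_eq_mul]
    exact le_of_eq (by linear_combination (-β) * hab)
  · exact ⟨fun x hx z hz y hy => ⟨⟨hx.1.1.trans hy.1, hy.2.trans hz.1.2⟩, hx.2⟩⟩
  · intro ι S y ν hν _ hy
    have : ∑ i ∈ S, |f (y i) - (α * y i + β)| = 0 :=
      Finset.sum_eq_zero fun i hi => by rw [hf _ (hy i hi), sub_self, abs_zero]
    rw [this]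
    positivity

lemma hasApprox_of_convex_monotone {f : ℝ → ℝ} {c d p r : ℝ} {m : ℕ} (hm : 0 < m) (hcd : c < d)
    (hcont : ContinuousOn f (Icc c d)) (hconv : ConvexOn ℝ (Icc c d) f)
    (hmono : MonotoneOn f (Icc c d)) (hlt : f c < f d)
    (hp : ∀ y ∈ Icc c d, f c + p * (y - c) ≤ f y)
    (hr : ∀ y ∈ Icc c d, y - d ≤ r * (f y - f d)) :
    HasApprox f c d (m + m) ((d - c) * (f d - f c) *
      (1 - 1 / 2 * (p / ((f d - f c) / (d - c)) + r * ((f d - f c) / (d - c)))) / m ^ 2) := by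
  have hm' : (0 : ℝ) < m := by exact_mod_cast hm
  have hℓ : 0 < d - c := by linarith
  have hV : 0 < f d - f c := by linarith
  have hcI : c ∈ Icc c d := ⟨le_rfl, hcd.le⟩
  have hdI : d ∈ Icc c d := ⟨hcd.le, le_rfl⟩
  set Δ := (f d - f c) / (d - c) with hΔ
  have hΔ0 : 0 < Δ := div_pos hV hℓ
  have hΔℓ : Δ * (d - c) = f d - f c := by rw [hΔ]; field_simp
  have hpΔ : p ≤ Δ := by
    rw [hΔ, le_div_iff₀ hℓ]
    linarith [hp d hdI]
  have hrΔ : r ≤ 1 / Δ := by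
    rw [le_div_iff₀ hΔ0, hΔ, mul_div_assoc', div_le_one hℓ]
    linarith [hr c hcI]
  have hKeq : (d - c) * (f d - f c) * (1 - 1 / 2 * (p / Δ + r * Δ)) / m ^ 2
      = ((d - c) / m) ^ 2 * (Δ - p) / 2 + ((f d - f c) / m) ^ 2 * (1 / Δ - r) / 2 := by
    rw [← hΔℓ]
    field_simp
    ring
  rw [hKeq]
  obtain ⟨z, hz, htouch⟩ := exists_touching_point hcd.le hcont Δ
  by_cases hend : z = c ∨ z = d
  · have hline : ∀ y ∈ Icc c d, f c + Δ * (y - c) ≤ f y := by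
      rcases hend with rfl | rfl
      · exact htouch
      · intro y hy
        have := htouch y hy
        nlinarith
    have haff : ∀ x ∈ Icc c d, f x = Δ * x + (f c - Δ * c) := by
      intro x hx
      have h1 := hline x hx
      have h2 := le_chordLine hconv hcI hdI hcd hx
      rw [chordLine, ← hΔ] at h2
      linarith
    refine hasApprox_of_affine (by omega) hcd.le ?_ haff
    have := sub_nonneg.2 hpΔ
    have := sub_nonneg.2 hrΔ
    positivity
  push Not at hend
  have hcz : c < z := lt_of_le_of_ne hz.1 (Ne.symm hend.1)
  have hzd : z < d := lt_of_le_of_ne hz.2 hend.2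
  have hpos : ∀ y ∈ Ioc z d, f z < f y := by
    intro y hy
    have h1 := htouch y ⟨hz.1.trans hy.1.le, hy.2⟩
    have h2 : 0 < Δ * (y - z) := mul_pos hΔ0 (by linarith [hy.1])
    linarith
  obtain ⟨t₁, B₁, a1, a2, a3, a4, a5⟩ := exists_equispaced_nodes hm hconv hcz hz.2 hp htouch
  obtain ⟨t₂, B₂, b1, b2, b3, b4, b5⟩ := exists_equivalued_nodes (s := 1 / Δ) hm hcont hconv hmono
    hz.1 hzd (hpos d ⟨hzd, le_rfl⟩) hpos
    (fun y hy => by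
      rw [one_div_mul_eq_div, le_div_iff₀ hΔ0]
      linarith [htouch y hy]) hr
  obtain ⟨t, B, rfl, rfl, c3, c4, c5⟩ := exists_concat_nodes
    (E := fun u v b => ∀ x ∈ Icc u v, (v - u) * (chordLine f u v x - f x) ≤ b)
    a1 a2 b1 b2 a3 b3 a4 b4
  obtain ⟨g, g1, g2, g3, g4, g5, g6, g7⟩ :=
    exists_interpolant_error (by omega) c3 hconv hmono c4
  refine ⟨g, g1.continuousOn, Or.inl (g2.monotoneOn _),
    Or.inl (g3.subset (subset_univ _) (convex_Icc _ _)), g4, g5, g6, ?_⟩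
  intro ι S y ν hν hcount hy
  refine (g7 ι S y ν hν hcount hy).trans (add_le_add (mul_le_mul_of_nonneg_left ?_ hν)
    (le_abs_self _))
  rw [c5, a5, b5]
  have q1 : ((z - t 0) / m) ^ 2 ≤ ((t (m + m) - t 0) / m) ^ 2 := by
    have : 0 ≤ z - t 0 := by linarith
    gcongr
  have q2 : ((f (t (m + m)) - f z) / m) ^ 2 ≤ ((f (t (m + m)) - f (t 0)) / m) ^ 2 := by
    have h1 := hmono hcI hz hz.1
    have h2 : 0 ≤ f (t (m + m)) - f z := by linarith [hmono hz hdI hz.2]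
    gcongr
  have q3 := mul_le_mul_of_nonneg_right q1 (sub_nonneg.2 hpΔ)
  have q4 := mul_le_mul_of_nonneg_right q2 (sub_nonneg.2 hrΔ)
  linarith

lemma linIndex_neg (p q : EReal) (Δ : ℝ) : linIndex (-p) (-q) (-Δ) = linIndex p q Δ := by
  simp [linIndex, EReal.abs_neg]

lemma linIndex_comm (p q : EReal) (Δ : ℝ) : linIndex p q Δ = linIndex q p Δ := by
  simp [linIndex, min_comm, max_comm]

/-- `p` and `q` are the right derivative at `c` and the left derivative at `d` of `f`. -/
def HasEndSlopes (f : ℝ → ℝ) (c d : ℝ) (p q : EReal) : Prop :=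
  Tendsto (fun y => (((f y - f c) / (y - c) : ℝ) : EReal)) (nhdsWithin c (Ioi c)) (nhds p) ∧
  Tendsto (fun y => (((f d - f y) / (d - y) : ℝ) : EReal)) (nhdsWithin d (Iio d)) (nhds q)

lemma HasEndSlopes.neg {f : ℝ → ℝ} {c d : ℝ} {p q : EReal} (h : HasEndSlopes f c d p q) :
    HasEndSlopes (fun x => -f x) c d (-p) (-q) := by
  refine ⟨(continuous_neg.tendsto p |>.comp h.1).congr fun y => ?_,
    (continuous_neg.tendsto q |>.comp h.2).congr fun y => ?_⟩
  · simp only [Function.comp]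
    rw [← EReal.coe_neg]
    congr 1
    ring
  · simp only [Function.comp]
    rw [← EReal.coe_neg]
    congr 1
    ring

lemma HasEndSlopes.reflect {f : ℝ → ℝ} {c d : ℝ} {p q : EReal} (h : HasEndSlopes f c d p q) :
    HasEndSlopes (fun x => f (-x)) (-d) (-c) (-q) (-p) := by
  have h1 : Tendsto (fun y : ℝ => -y) (nhdsWithin (-d) (Ioi (-d))) (nhdsWithin d (Iio d)) := by
    simpa using tendsto_neg_nhdsGT (a := -d)
  have h2 : Tendsto (fun y : ℝ => -y) (nhdsWithin (-c) (Iio (-c))) (nhdsWithin c (Ioi c)) := by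
    simpa using tendsto_neg_nhdsLT (a := -c)
  refine ⟨(continuous_neg.tendsto q |>.comp (h.2.comp h1)).congr fun y => ?_,
    (continuous_neg.tendsto p |>.comp (h.1.comp h2)).congr fun y => ?_⟩
  · simp only [Function.comp]
    rw [← EReal.coe_neg, ← neg_div, neg_sub, neg_neg, show y - -d = d - -y by ring]
  · simp only [Function.comp]
    rw [← EReal.coe_neg, ← neg_div, neg_sub, neg_neg, show -y - c = -c - y by ring]

/-- The approximation property satisfied by a function on a piece on which it is monotone and
convex or concave. -/
def SlopeApprox (f : ℝ → ℝ) (c d : ℝ) (p q : EReal) : Prop :=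
  linIndex p q ((f d - f c) / (d - c)) ∈ Icc 0 1 ∧
  ∀ m : ℕ, 0 < m → HasApprox f c d (m + m)
    ((d - c) * |f d - f c| * linIndex p q ((f d - f c) / (d - c)) / m ^ 2)

lemma SlopeApprox.of_neg {f : ℝ → ℝ} {c d : ℝ} {p q : EReal}
    (h : SlopeApprox (fun x => -f x) c d (-p) (-q)) : SlopeApprox f c d p q := by
  have e1 : (-f d - -f c) / (d - c) = -((f d - f c) / (d - c)) := by ring
  have e2 : |-f d - -f c| = |f d - f c| := by rw [← abs_neg]; congr 1; ring
  unfold SlopeApprox at h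
  rw [e1, e2, linIndex_neg] at h
  exact ⟨h.1, fun m hm => (h.2 m hm).of_neg⟩

lemma SlopeApprox.of_reflect {f : ℝ → ℝ} {c d : ℝ} {p q : EReal}
    (h : SlopeApprox (fun x => f (-x)) (-d) (-c) (-q) (-p)) : SlopeApprox f c d p q := by
  unfold SlopeApprox at h
  simp only [neg_neg] at h
  have e1 : (f c - f d) / (-c - -d) = -((f d - f c) / (d - c)) := by
    rw [← neg_div]; congr 1 <;> ring
  have e2 : -c - -d = d - c := by ring
  rw [e1, e2, abs_sub_comm, linIndex_neg, linIndex_comm] at h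
  exact ⟨h.1, fun m hm => (h.2 m hm).of_reflect⟩

lemma HasEndSlopes.of_convex_monotone {f : ℝ → ℝ} {c d : ℝ} {p q : EReal} (hcd : c < d)
    (hconv : ConvexOn ℝ (Icc c d) f) (hmono : MonotoneOn f (Icc c d))
    (h : HasEndSlopes f c d p q) :
    (∃ p' : ℝ, p = p' ∧ 0 ≤ p' ∧ ∀ y ∈ Icc c d, f c + p' * (y - c) ≤ f y) ∧
    (q = ⊤ ∨ ∃ q' : ℝ, q = q' ∧ ∀ y ∈ Icc c d, f d + q' * (y - d) ≤ f y) := by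
  have hcI : c ∈ Icc c d := ⟨le_rfl, hcd.le⟩
  have hdI : d ∈ Icc c d := ⟨hcd.le, le_rfl⟩
  have hp0 : (0 : EReal) ≤ p := by
    refine ge_of_tendsto h.1 ?_
    filter_upwards [Ioo_mem_nhdsGT hcd] with y hy
    rw [← EReal.coe_zero, EReal.coe_le_coe_iff]
    exact div_nonneg (sub_nonneg.2 (hmono hcI ⟨hy.1.le, hy.2.le⟩ hy.1.le)) (by linarith [hy.1])
  have hp1 : ∀ y ∈ Ioc c d, p ≤ ((f y - f c) / (y - c) : ℝ) := by
    intro y hy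
    refine le_of_tendsto h.1 ?_
    filter_upwards [Ioo_mem_nhdsGT hy.1] with x hx
    rw [EReal.coe_le_coe_iff]
    exact hconv.secant_mono_aux2 hcI ⟨hy.1.le, hy.2⟩ hx.1 hx.2
  have hq1 : ∀ y ∈ Ico c d, (((f d - f y) / (d - y) : ℝ) : EReal) ≤ q := by
    intro y hy
    refine ge_of_tendsto h.2 ?_
    filter_upwards [Ioo_mem_nhdsLT hy.2] with x hx
    rw [EReal.coe_le_coe_iff]
    exact hconv.secant_mono_aux3 ⟨hy.1, hy.2.le⟩ hdI hx.1 hx.2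
  constructor
  · induction p with
    | bot => simp at hp0
    | top => simpa using hp1 d ⟨hcd, le_rfl⟩
    | coe p' =>
      refine ⟨p', rfl, by exact_mod_cast hp0, fun y hy => ?_⟩
      rcases hy.1.eq_or_lt with rfl | hcy
      · simp
      · have := hp1 y ⟨hcy, hy.2⟩
        rw [EReal.coe_le_coe_iff, le_div_iff₀ (by linarith)] at this
        linarith
  · induction q with
    | bot => simpa using hq1 c ⟨le_rfl, hcd⟩
    | top => exact Or.inl rfl
    | coe q' =>
      refine Or.inr ⟨q', rfl, fun y hy => ?_⟩
      rcases hy.2.eq_or_lt with rfl | hyd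
      · simp
      · have := hq1 y ⟨hy.1, hyd⟩
        rw [EReal.coe_le_coe_iff, div_le_iff₀ (by linarith)] at this
        linarith

lemma cdiv_ofReal_toReal {x y : ℝ} (hx : 0 ≤ x) (hy : 0 ≤ y) (h : x ≠ 0 ∨ y ≠ 0) :
    (cdiv (ENNReal.ofReal x) (ENNReal.ofReal y)).toReal = x / y := by
  have : ¬ (ENNReal.ofReal x = 0 ∧ ENNReal.ofReal y = 0) := by
    rw [ENNReal.ofReal_eq_zero, ENNReal.ofReal_eq_zero]
    rintro ⟨h1, h2⟩
    rcases h with h | h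
    · exact h (le_antisymm h1 hx)
    · exact h (le_antisymm h2 hy)
  rw [cdiv, if_neg this, ENNReal.toReal_div, ENNReal.toReal_ofReal hx, ENNReal.toReal_ofReal hy]

lemma linIndex_top {p Δ : ℝ} (hp : 0 ≤ p) (hΔ : 0 < Δ) :
    linIndex p ⊤ Δ = 1 - 1 / 2 * (p / Δ + 0 * Δ) := by
  rw [linIndex, EReal.abs_def, EReal.abs_top, min_eq_left le_top, max_eq_right le_top,
    abs_of_nonneg hp, abs_of_pos hΔ, cdiv_ofReal_toReal hp hΔ.le (Or.inr hΔ.ne')]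
  simp [cdiv]

lemma linIndex_coe {p q Δ : ℝ} (hp : 0 ≤ p) (hpq : p ≤ q) (hΔ : 0 < Δ) :
    linIndex p q Δ = 1 - 1 / 2 * (p / Δ + 1 / q * Δ) := by
  have hq := hp.trans hpq
  have hle := ENNReal.ofReal_le_ofReal hpq
  rw [linIndex, EReal.abs_def, EReal.abs_def, abs_of_nonneg hp, abs_of_nonneg hq, abs_of_pos hΔ,
    min_eq_left hle, max_eq_right hle, cdiv_ofReal_toReal hp hΔ.le (Or.inr hΔ.ne'),
    cdiv_ofReal_toReal hΔ.le hq (Or.inl hΔ.ne')]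
  ring

lemma slopeApprox_of_convex_monotone {f : ℝ → ℝ} {c d : ℝ} {p q : EReal} (hcd : c < d)
    (hcont : ContinuousOn f (Icc c d)) (hconv : ConvexOn ℝ (Icc c d) f)
    (hmono : MonotoneOn f (Icc c d)) (hne : f c ≠ f d) (h : HasEndSlopes f c d p q) :
    SlopeApprox f c d p q := by
  have hcI : c ∈ Icc c d := ⟨le_rfl, hcd.le⟩
  have hdI : d ∈ Icc c d := ⟨hcd.le, le_rfl⟩
  have hlt : f c < f d := lt_of_le_of_ne (hmono hcI hdI hcd.le) hne
  have hℓ : 0 < d - c := by linarith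
  have hV : 0 < f d - f c := by linarith
  have hΔ : 0 < (f d - f c) / (d - c) := div_pos hV hℓ
  obtain ⟨⟨p', rfl, hp0, hp⟩, hq⟩ := h.of_convex_monotone hcd hconv hmono
  have hpΔ : p' ≤ (f d - f c) / (d - c) := by
    rw [le_div_iff₀ hℓ]
    linarith [hp d hdI]
  obtain ⟨r, hr0, hr, hlin⟩ : ∃ r : ℝ, 0 ≤ r ∧ (∀ y ∈ Icc c d, y - d ≤ r * (f y - f d)) ∧
      linIndex p' q ((f d - f c) / (d - c)) = 1 - 1 / 2 *
        (p' / ((f d - f c) / (d - c)) + r * ((f d - f c) / (d - c))) := by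
    rcases hq with rfl | ⟨q', rfl, hq⟩
    · exact ⟨0, le_rfl, fun y hy => by linarith [hy.2], linIndex_top hp0 hΔ⟩
    · have hΔq : (f d - f c) / (d - c) ≤ q' := by
        rw [div_le_iff₀ hℓ]
        linarith [hq c hcI]
      have hq0 : 0 < q' := hΔ.trans_le hΔq
      refine ⟨1 / q', by positivity, fun y hy => ?_, linIndex_coe hp0 (hpΔ.trans hΔq) hΔ⟩
      rw [one_div_mul_eq_div, le_div_iff₀ hq0]
      linarith [hq y hy]
  have h1 : p' / ((f d - f c) / (d - c)) ≤ 1 := (div_le_one hΔ).2 hpΔ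
  have h2 : r * ((f d - f c) / (d - c)) ≤ 1 := by
    rw [mul_div_assoc', div_le_one hℓ]
    linarith [hr c hcI]
  have h3 : 0 ≤ p' / ((f d - f c) / (d - c)) := by positivity
  have h4 : 0 ≤ r * ((f d - f c) / (d - c)) := by positivity
  refine ⟨?_, fun m hm => ?_⟩
  · rw [hlin]
    constructor <;> linarith
  · rw [hlin, abs_of_pos hV]
    exact hasApprox_of_convex_monotone hm hcd hcont hconv hmono hlt hp hr

lemma slopeApprox_of_monotone {f : ℝ → ℝ} {c d : ℝ} {p q : EReal} (hcd : c < d)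
    (hcont : ContinuousOn f (Icc c d)) (hmono : MonotoneOn f (Icc c d))
    (hconv : ConvexOn ℝ (Icc c d) f ∨ ConcaveOn ℝ (Icc c d) f)
    (hne : f c ≠ f d) (h : HasEndSlopes f c d p q) : SlopeApprox f c d p q := by
  rcases hconv with hconv | hconc
  · exact slopeApprox_of_convex_monotone hcd hcont hconv hmono hne h
  have hmaps : ∀ x ∈ Icc (-d) (-c), -x ∈ Icc c d := fun x hx =>
    ⟨by linarith [hx.2], by linarith [hx.1]⟩
  refine SlopeApprox.of_neg (SlopeApprox.of_reflect ?_)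
  refine slopeApprox_of_convex_monotone (neg_lt_neg hcd)
    (hcont.neg.comp continuous_neg.continuousOn hmaps) ?_ ?_ ?_ h.neg.reflect
  · refine ⟨convex_Icc _ _, fun x hx y hy a b ha hb hab => ?_⟩
    have := hconc.neg.2 (hmaps x hx) (hmaps y hy) ha hb hab
    simp only [smul_eq_mul, Pi.neg_apply] at this ⊢
    rwa [show -(a * x + b * y) = a * -x + b * -y by ring]
  · intro x hx y hy hxy
    exact neg_le_neg (hmono (hmaps y hy) (hmaps x hx) (neg_le_neg hxy))
  · simpa using hne.symm

lemma slopeApprox_of_monotone_or_antitone {f : ℝ → ℝ} {c d : ℝ} {p q : EReal} (hcd : c < d)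
    (hcont : ContinuousOn f (Icc c d))
    (hmono : MonotoneOn f (Icc c d) ∨ AntitoneOn f (Icc c d))
    (hconv : ConvexOn ℝ (Icc c d) f ∨ ConcaveOn ℝ (Icc c d) f)
    (hne : f c ≠ f d) (h : HasEndSlopes f c d p q) : SlopeApprox f c d p q := by
  rcases hmono with hmono | hanti
  · exact slopeApprox_of_monotone hcd hcont hmono hconv hne h
  refine SlopeApprox.of_neg (slopeApprox_of_monotone hcd hcont.neg hanti.neg
    (hconv.symm.imp (fun h => h.neg) (fun h => h.neg)) ?_ h.neg)
  simpa using hne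

lemma hasApprox_of_monotone_or_antitone {f : ℝ → ℝ} {c d : ℝ} {p q : EReal} (hcd : c < d)
    (hcont : ContinuousOn f (Icc c d))
    (hmono : MonotoneOn f (Icc c d) ∨ AntitoneOn f (Icc c d))
    (hconv : ConvexOn ℝ (Icc c d) f ∨ ConcaveOn ℝ (Icc c d) f) (h : HasEndSlopes f c d p q) :
    |f d - f c| * linIndex p q ((f d - f c) / (d - c)) ∈ Icc 0 |f d - f c| ∧
    ∀ m : ℕ, 0 < m → HasApprox f c d (m + m)
      ((d - c) * (|f d - f c| * linIndex p q ((f d - f c) / (d - c))) / m ^ 2) := by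
  by_cases hne : f c = f d
  · have hconst : ∀ x ∈ Icc c d, f x = 0 * x + f c := by
      intro x hx
      have hcI : c ∈ Icc c d := ⟨le_rfl, hcd.le⟩
      have hdI : d ∈ Icc c d := ⟨hcd.le, le_rfl⟩
      rw [zero_mul, zero_add]
      rcases hmono with hm | hm
      · exact le_antisymm (hne ▸ hm hx hdI hx.2) (hm hcI hx hx.1)
      · exact le_antisymm (hm hcI hx hx.1) (hne ▸ hm hx hdI hx.2)
    have h0 : |f d - f c| = 0 := by rw [hne, sub_self, abs_zero]
    rw [h0]
    refine ⟨by simp, fun m hm => hasApprox_of_affine (by omega) hcd.le (by simp) hconst⟩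
  · obtain ⟨h1, h2⟩ := slopeApprox_of_monotone_or_antitone hcd hcont hmono hconv hne h
    refine ⟨⟨mul_nonneg (abs_nonneg _) h1.1, mul_le_of_le_one_right (abs_nonneg _) h1.2⟩,
      fun m hm => ?_⟩
    rw [← mul_assoc]
    exact h2 m hm

lemma Set.OrdConnected.interval_bounds {J : Set ℝ} {A B : ℝ} (hJ : J.OrdConnected)
    (hnt : J.Nontrivial) (hsub : J ⊆ Icc A B) :
    sInf J < sSup J ∧ Ioo (sInf J) (sSup J) ⊆ J ∧ J ⊆ Icc (sInf J) (sSup J) ∧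
      closure J = Icc (sInf J) (sSup J) ∧ Icc (sInf J) (sSup J) ⊆ Icc A B := by
  have hb : BddBelow J := ⟨A, fun x hx => (hsub hx).1⟩
  have ha : BddAbove J := ⟨B, fun x hx => (hsub hx).2⟩
  have hIcc : J ⊆ Icc (sInf J) (sSup J) := subset_Icc_csInf_csSup hb ha
  obtain ⟨u, hu, v, hv, huv⟩ := hnt.exists_lt
  have hlt : sInf J < sSup J := (hIcc hu).1.trans_lt (huv.trans_le (hIcc hv).2)
  have hIoo : Ioo (sInf J) (sSup J) ⊆ J :=
    IsConnected.Ioo_csInf_csSup_subset ⟨hnt.nonempty, hJ.isPreconnected⟩ hb ha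
  refine ⟨hlt, hIoo, hIcc, ?_, ?_⟩
  · refine Subset.antisymm (closure_minimal hIcc isClosed_Icc) ?_
    rw [← closure_Ioo hlt.ne]
    exact closure_mono hIoo
  · exact Icc_subset_Icc (le_csInf hnt.nonempty fun x hx => (hsub hx).1)
      (csSup_le hnt.nonempty fun x hx => (hsub hx).2)

lemma realVarOn_eq {f : ℝ → ℝ} {J : Set ℝ} {c d : ℝ} (hcd : c ≤ d) (hJ : closure J = Icc c d)
    (hmono : MonotoneOn f (Icc c d) ∨ AntitoneOn f (Icc c d)) :
    realVarOn f J = |f d - f c| := by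
  have hcI : c ∈ Icc c d := ⟨le_rfl, hcd⟩
  have hdI : d ∈ Icc c d := ⟨hcd, le_rfl⟩
  rw [realVarOn, hJ]
  rcases hmono with hm | hm
  · have h1 : IsGreatest (f '' Icc c d) (f d) :=
      ⟨⟨d, hdI, rfl⟩, by rintro _ ⟨x, hx, rfl⟩; exact hm hx hdI hx.2⟩
    have h2 : IsLeast (f '' Icc c d) (f c) :=
      ⟨⟨c, hcI, rfl⟩, by rintro _ ⟨x, hx, rfl⟩; exact hm hcI hx hx.1⟩
    rw [h1.csSup_eq, h2.csInf_eq, abs_of_nonneg (sub_nonneg.2 (hm hcI hdI hcd))]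
  · have h1 : IsGreatest (f '' Icc c d) (f c) :=
      ⟨⟨c, hcI, rfl⟩, by rintro _ ⟨x, hx, rfl⟩; exact hm hcI hx hx.1⟩
    have h2 : IsLeast (f '' Icc c d) (f d) :=
      ⟨⟨d, hdI, rfl⟩, by rintro _ ⟨x, hx, rfl⟩; exact hm hx hdI hx.2⟩
    rw [h1.csSup_eq, h2.csInf_eq, abs_sub_comm, abs_of_nonneg (sub_nonneg.2 (hm hcI hdI hcd))]

lemma equispaced_eq {n : ℕ} {x : Fin n → ℝ} {δ : ℝ} (hn : 0 < n)
    (hx : ∀ (i : ℕ) (h1 : i + 1 < n), x ⟨i + 1, h1⟩ - x ⟨i, Nat.lt_of_succ_lt h1⟩ = δ)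
    (i : Fin n) : x i = x ⟨0, hn⟩ + (i : ℕ) * δ := by
  obtain ⟨i, hi⟩ := i
  induction i with
  | zero => simp
  | succ i ih =>
    have h1 := hx i hi
    have h2 := ih (Nat.lt_of_succ_lt hi)
    push_cast at h2 ⊢
    linarith

lemma countBound_of_equispaced {n : ℕ} {x : Fin n → ℝ} {x₀ δ : ℝ} (hδ : 0 < δ)
    (hx : ∀ i, x i = x₀ + (i : ℕ) * δ) : CountBound Finset.univ x δ⁻¹ := by
  intro u v huv
  set T := Finset.univ.filter fun i => x i ∈ Icc u v
  have hle : T.card ≤ (Finset.Icc ⌈(u - x₀) / δ⌉ ⌊(v - x₀) / δ⌋).card := by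
    refine Finset.card_le_card_of_injOn (fun i : Fin n => ((i : ℕ) : ℤ)) (fun i hi => ?_) ?_
    · obtain ⟨-, h1, h2⟩ := Finset.mem_filter.1 hi
      rw [hx] at h1 h2
      simp only [Finset.coe_Icc, mem_Icc, Int.ceil_le, Int.le_floor, div_le_iff₀ hδ,
        le_div_iff₀ hδ, Int.cast_natCast]
      constructor <;> linarith
    · intro i _ j _ hij
      have hij' : ((i : ℕ) : ℤ) = ((j : ℕ) : ℤ) := hij
      exact Fin.ext (by exact_mod_cast hij')
  have hle' : (T.card : ℝ) ≤ ((⌊(v - x₀) / δ⌋ + 1 - ⌈(u - x₀) / δ⌉).toNat : ℝ) := by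
    rw [Int.card_Icc] at hle
    exact_mod_cast hle
  refine hle'.trans ?_
  have h0 : 0 ≤ δ⁻¹ * (v - u) := mul_nonneg (inv_nonneg.2 hδ.le) (by linarith)
  rcases le_total (⌊(v - x₀) / δ⌋ + 1 - ⌈(u - x₀) / δ⌉) 0 with h | h
  · rw [Int.toNat_of_nonpos h]
    push_cast
    linarith
  · have e : ((⌊(v - x₀) / δ⌋ + 1 - ⌈(u - x₀) / δ⌉).toNat : ℝ)
        = ((⌊(v - x₀) / δ⌋ + 1 - ⌈(u - x₀) / δ⌉ : ℤ) : ℝ) := by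
      rw [← Int.cast_natCast, Int.toNat_of_nonneg h]
    rw [e]
    push_cast
    have h1 := Int.floor_le ((v - x₀) / δ)
    have h2 := Int.le_ceil ((u - x₀) / δ)
    have h3 : δ⁻¹ * (v - u) = (v - x₀) / δ - (u - x₀) / δ := by field_simp; ring
    linarith

lemma le_nPts_add_one {n : ℕ} {x : Fin n → ℝ} {x₀ δ c d : ℝ} {J : Set ℝ} (hδ : 0 < δ)
    (hx : ∀ i, x i = x₀ + (i : ℕ) * δ) (hJ : Ioo c d ⊆ J) (hc : x₀ - δ ≤ c)
    (hd : d ≤ x₀ + n * δ) : δ⁻¹ * (d - c) ≤ nPts x J + 1 := by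
  set s := ⌊(c - x₀) / δ⌋ with hs
  set e := ⌈(d - x₀) / δ⌉ with he
  have hs1 : -1 ≤ s := by
    rw [hs, Int.le_floor, le_div_iff₀ hδ]
    push_cast
    linarith
  have he1 : e ≤ n := by
    rw [he, Int.ceil_le, div_le_iff₀ hδ]
    push_cast
    linarith
  have hsub : Finset.Ioo s e ⊆
      (Finset.univ.filter fun i => x i ∈ J).image fun i : Fin n => ((i : ℕ) : ℤ) := by
    intro k hk
    obtain ⟨h1, h2⟩ := Finset.mem_Ioo.1 hk
    obtain ⟨i, rfl⟩ := Int.eq_ofNat_of_zero_le (show 0 ≤ k by omega)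
    have hi : i < n := by omega
    refine Finset.mem_image.2 ⟨⟨i, hi⟩, Finset.mem_filter.2 ⟨Finset.mem_univ _, hJ ?_⟩, rfl⟩
    rw [hs, Int.floor_lt, div_lt_iff₀ hδ] at h1
    rw [he, Int.lt_ceil, lt_div_iff₀ hδ] at h2
    rw [hx]
    push_cast at h1 h2 ⊢
    constructor <;> linarith
  have hcard := (Finset.card_le_card hsub).trans Finset.card_image_le
  rw [Int.card_Ioo] at hcard
  have h1 : e - s - 1 ≤ (nPts x J : ℤ) := by
    have : ((e - s - 1).toNat : ℤ) ≤ nPts x J := by exact_mod_cast hcard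
    exact (Int.self_le_toNat _).trans this
  have h2 : (e : ℝ) - s - 1 ≤ nPts x J := by exact_mod_cast h1
  have h3 := Int.floor_le ((c - x₀) / δ)
  have h4 := Int.le_ceil ((d - x₀) / δ)
  have h5 : δ⁻¹ * (d - c) = (d - x₀) / δ - (c - x₀) / δ := by field_simp; ring
  linarith

lemma IsIntervalPartition.exists_glue {𝒳 : Set ℝ} {P : Finset (Set ℝ)}
    (hP : IsIntervalPartition 𝒳 P) (g : Set ℝ → ℝ → ℝ) :
    ∃ h : ℝ → ℝ, ∀ J ∈ P, ∀ y ∈ J, h y = g J y := by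
  refine ⟨fun y => if hy : ∃ J ∈ P, y ∈ J then g hy.choose y else 0, fun J hJ y hyJ => ?_⟩
  have hy : ∃ J ∈ P, y ∈ J := ⟨J, hJ, hyJ⟩
  have : hy.choose = J :=
    (hP.2 y ((hP.1 J hJ).2.2 hyJ)).unique hy.choose_spec ⟨hJ, hyJ⟩
  simp only [dif_pos hy, this]

lemma IsIntervalPartition.glue_eq_on_closure {A B : ℝ} {P : Finset (Set ℝ)}
    (hP : IsIntervalPartition (Icc A B) P) {f h : ℝ → ℝ} {g : Set ℝ → ℝ → ℝ}
    (hh : ∀ J ∈ P, ∀ y ∈ J, h y = g J y) (hinf : ∀ J ∈ P, g J (sInf J) = f (sInf J))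
    (hsup : ∀ J ∈ P, g J (sSup J) = f (sSup J)) :
    ∀ J ∈ P, ∀ y ∈ closure J, h y = g J y := by
  have hend : ∀ J ∈ P, ∀ y ∈ closure J, y ∉ Ioo (sInf J) (sSup J) → g J y = f y := by
    intro J hJ y hy hyn
    obtain ⟨h1, h2, h3⟩ := hP.1 J hJ
    rw [(h1.interval_bounds h2 h3).2.2.2.1] at hy
    rcases hy.1.eq_or_lt with rfl | hlt
    · exact hinf J hJ
    rcases hy.2.eq_or_lt with rfl | hlt'
    · exact hsup J hJ
    exact absurd ⟨hlt, hlt'⟩ hyn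
  intro J hJ y hy
  by_cases hyJ : y ∈ J
  · exact hh J hJ y hyJ
  obtain ⟨h1, h2, h3⟩ := hP.1 J hJ
  obtain ⟨-, hIoo, -, hcl, hsub⟩ := h1.interval_bounds h2 h3
  have hyX : y ∈ Icc A B := hsub (hcl ▸ hy)
  obtain ⟨J', ⟨hJ', hyJ'⟩, -⟩ := hP.2 y hyX
  obtain ⟨h1', h2', h3'⟩ := hP.1 J' hJ'
  obtain ⟨-, hIoo', -, -, -⟩ := h1'.interval_bounds h2' h3'
  rw [hh J' hJ' y hyJ', hend J hJ y hy fun hmem => hyJ (hIoo hmem),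
    hend J' hJ' y (subset_closure hyJ')]
  intro hmem
  obtain ⟨w, hw, hwJ⟩ := mem_closure_iff.1 hy _ isOpen_Ioo hmem
  have : J = J' := (hP.2 w (h3 hwJ)).unique ⟨hJ, hwJ⟩ ⟨hJ', hIoo' hw⟩
  exact hyJ (this ▸ hyJ')

lemma IsIntervalPartition.continuousOn {𝒳 : Set ℝ} {P : Finset (Set ℝ)}
    (hP : IsIntervalPartition 𝒳 P) {h : ℝ → ℝ} (hc : ∀ J ∈ P, ContinuousOn h (closure J)) :
    ContinuousOn h 𝒳 := by
  have := (locallyFinite_of_finite fun J : P => closure (J : Set ℝ)).continuousOn_iUnion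
    (g := h) (fun _ => isClosed_closure) fun J => hc J J.2
  refine this.mono fun y hy => ?_
  obtain ⟨J, ⟨hJ, hyJ⟩, -⟩ := hP.2 y hy
  exact mem_iUnion.2 ⟨⟨J, hJ⟩, subset_closure hyJ⟩

lemma IsIntervalPartition.piecewiseLinear {𝒳 : Set ℝ} {P : Finset (Set ℝ)}
    (hP : IsIntervalPartition 𝒳 P) {h : ℝ → ℝ} {N : Set ℝ → ℕ} {K : ℕ}
    (hc : ContinuousOn h 𝒳) (ha : ∀ J ∈ P, AffineOnFibers h J (N J))
    (hK : ∑ J ∈ P, N J ≤ K) : PiecewiseLinear 𝒳 K h := by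
  have hidx : ∀ J, ∃ idx : ℝ → ℕ, J ∈ P → (∀ y ∈ J, idx y < N J) ∧
      (∀ i, (J ∩ idx ⁻¹' {i}).OrdConnected) ∧
      ∀ i, ∃ α β : ℝ, ∀ y ∈ J, idx y = i → h y = α * y + β := by
    intro J
    by_cases hJ : J ∈ P
    · obtain ⟨idx, hi⟩ := ha J hJ
      exact ⟨idx, fun _ => hi⟩
    · exact ⟨fun _ => 0, fun h => absurd h hJ⟩
  choose idx hidx using hidx
  refine ⟨hc, P.biUnion fun J => (Finset.range (N J)).image fun i => J ∩ idx J ⁻¹' {i},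
    ?_, ⟨?_, ?_⟩, ?_⟩
  · refine (Finset.card_biUnion_le.trans (Finset.sum_le_sum fun J _ => ?_)).trans hK
    exact Finset.card_image_le.trans (Finset.card_range _).le
  · intro Q hQ
    obtain ⟨J, hJ, hQ⟩ := Finset.mem_biUnion.1 hQ
    obtain ⟨i, -, rfl⟩ := Finset.mem_image.1 hQ
    exact ⟨(hidx J hJ).2.1 i, inter_subset_left.trans (hP.1 J hJ).2.2⟩
  · intro y hy
    obtain ⟨J, ⟨hJ, hyJ⟩, huniq⟩ := hP.2 y hy
    refine ⟨J ∩ idx J ⁻¹' {idx J y}, ⟨?_, hyJ, rfl⟩, ?_⟩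
    · exact Finset.mem_biUnion.2 ⟨J, hJ, Finset.mem_image.2
        ⟨idx J y, Finset.mem_range.2 ((hidx J hJ).1 y hyJ), rfl⟩⟩
    · rintro Q ⟨hQ, hyQ⟩
      obtain ⟨J', hJ', hQ⟩ := Finset.mem_biUnion.1 hQ
      obtain ⟨i, -, rfl⟩ := Finset.mem_image.1 hQ
      obtain rfl := huniq J' ⟨hJ', hyQ.1⟩
      have : idx J' y = i := hyQ.2
      rw [this]
  · intro Q hQ
    obtain ⟨J, hJ, hQ⟩ := Finset.mem_biUnion.1 hQ
    obtain ⟨i, -, rfl⟩ := Finset.mem_image.1 hQ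
    obtain ⟨α, β, hαβ⟩ := (hidx J hJ).2.2 i
    exact ⟨α, β, fun y hy => hαβ y hy.1 hy.2⟩

lemma AffineOnFibers.congr_subset {g h : ℝ → ℝ} {I J : Set ℝ} {N : ℕ}
    (hg : AffineOnFibers g I N) (hJ : J.OrdConnected) (hJI : J ⊆ I) (hgh : ∀ y ∈ J, h y = g y) :
    AffineOnFibers h J N := by
  obtain ⟨idx, h1, h2, h3⟩ := hg
  refine ⟨idx, fun y hy => h1 y (hJI hy), fun i => ?_, fun i => ?_⟩
  · have := hJ.inter (h2 i)
    rwa [← inter_assoc, inter_eq_left.2 hJI] at this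
  · obtain ⟨α, β, h⟩ := h3 i
    exact ⟨α, β, fun y hy hi => by rw [hgh y hy, h y (hJI hy) hi]⟩

/-- Allocation of pieces in proportion to the cube roots of nonnegative weights. -/
lemma exists_allocation {ι : Type*} (P : Finset ι) (w : ι → ℝ) (hw : ∀ J ∈ P, 0 ≤ w J) {γ : ℝ}
    (hγ : 0 < γ) :
    ∃ m : ι → ℕ, (∀ J, 0 < m J) ∧ ((∑ J ∈ P, m J : ℕ) : ℝ) ≤ P.card + γ ∧
      ∑ J ∈ P, w J / (m J : ℝ) ^ 2 ≤ (∑ J ∈ P, w J ^ ((1 : ℝ) / 3)) ^ 3 / γ ^ 2 := by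
  set b : ι → ℝ := fun J => w J ^ ((1 : ℝ) / 3) with hb
  have hb0 : ∀ J ∈ P, 0 ≤ b J := fun J hJ => Real.rpow_nonneg (hw J hJ) _
  have hb3 : ∀ J ∈ P, b J ^ 3 = w J := by
    intro J hJ
    rw [hb, ← Real.rpow_natCast, ← Real.rpow_mul (hw J hJ)]
    norm_num
  set S := ∑ J ∈ P, b J with hS
  have hS0 : 0 ≤ S := Finset.sum_nonneg hb0
  have hfrac : ∀ J ∈ P, 0 ≤ γ * b J / S := fun J hJ =>
    div_nonneg (mul_nonneg hγ.le (hb0 J hJ)) hS0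
  refine ⟨fun J => 1 + ⌊γ * b J / S⌋₊, fun J => Nat.add_pos_left one_pos _, ?_, ?_⟩
  · push_cast
    rw [Finset.sum_add_distrib]
    have h1 : ∑ J ∈ P, ((⌊γ * b J / S⌋₊ : ℕ) : ℝ) ≤ ∑ J ∈ P, γ * b J / S :=
      Finset.sum_le_sum fun J hJ => Nat.floor_le (hfrac J hJ)
    have h2 : ∑ J ∈ P, γ * b J / S ≤ γ := by
      rw [← Finset.sum_div, ← Finset.mul_sum, ← hS]
      exact div_le_of_le_mul₀ hS0 hγ.le le_rfl
    simp only [Finset.sum_const, nsmul_eq_mul, mul_one]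
    linarith
  · have hterm : ∀ J ∈ P, w J / ((1 + ⌊γ * b J / S⌋₊ : ℕ) : ℝ) ^ 2 ≤ b J * (S ^ 2 / γ ^ 2) := by
      intro J hJ
      set m : ℝ := ((1 + ⌊γ * b J / S⌋₊ : ℕ) : ℝ) with hm
      have hm0 : 0 < m := by rw [hm]; positivity
      have hle : γ * b J ≤ m * S := by
        rcases hS0.eq_or_lt with h | h
        · have : b J = 0 := le_antisymm
            (by rw [h]; exact Finset.single_le_sum hb0 hJ) (hb0 J hJ)
          rw [this, ← h]
          simp
        · rw [← div_le_iff₀ h, hm]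
          push_cast
          linarith [Nat.lt_floor_add_one (γ * b J / S)]
      have hsq : (γ * b J) ^ 2 ≤ (m * S) ^ 2 :=
        pow_le_pow_left₀ (mul_nonneg hγ.le (hb0 J hJ)) hle 2
      rw [← hb3 J hJ, mul_div_assoc', div_le_div_iff₀ (by positivity) (by positivity)]
      have := mul_le_mul_of_nonneg_left hsq (hb0 J hJ)
      nlinarith
    refine (Finset.sum_le_sum hterm).trans (le_of_eq ?_)
    rw [← Finset.sum_mul, ← hS]
    ring

/-- Proposition 5: let `𝒳` be a compact interval of length `L > 0`
with equispaced design points, and `f ∈ C_k` with total variation `V` and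
`𝒥`-variation-index `W`. For every `γ > 0` there exists a `⌊2(k+γ)⌋`-piecewise linear
function `fbar ∈ C_k` such that `(1/n)·∑ᵢ |f(xᵢ) − fbar(xᵢ)| ≤ W/γ² + 2V/n`. -/
theorem stmt7 (a L : ℝ) (hL : 0 < L) (n : ℕ) (hn : 0 < n)
    (x : Fin n → ℝ) (hxmem : ∀ i, x i ∈ Set.Icc a (a + L))
    (hxeq : ∀ (i : ℕ) (h1 : i + 1 < n), x ⟨i + 1, h1⟩ - x ⟨i, Nat.lt_of_succ_lt h1⟩ = L / n)
    (k : ℕ) (hk : 1 ≤ k) (f : ℝ → ℝ) (hfcont : ContinuousOn f (Set.Icc a (a + L)))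
    (P : Finset (Set ℝ)) (hPcard : P.card ≤ k)
    (hP : IsIntervalPartition (Set.Icc a (a + L)) P)
    (hf : ∀ J ∈ P, (MonotoneOn f (closure J) ∨ AntitoneOn f (closure J)) ∧
      (ConvexOn ℝ (closure J) f ∨ ConcaveOn ℝ (closure J) f))
    (dr dl : Set ℝ → EReal)
    (hdr : ∀ J ∈ P, Tendsto (fun y => (((f y - f (sInf J)) / (y - sInf J) : ℝ) : EReal))
      (nhdsWithin (sInf J) (Set.Ioi (sInf J))) (nhds (dr J)))
    (hdl : ∀ J ∈ P, Tendsto (fun y => (((f (sSup J) - f y) / (sSup J - y) : ℝ) : EReal))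
      (nhdsWithin (sSup J) (Set.Iio (sSup J))) (nhds (dl J)))
    (V W : ℝ) (hV : V = ∑ J ∈ P, realVarOn f J)
    (hW : W = (∑ J ∈ P, ((nPts x J : ℝ) * realVarOn f J *
        linIndex (dr J) (dl J) ((f (sSup J) - f (sInf J)) / (sSup J - sInf J)) / n)
          ^ ((1 : ℝ) / 3)) ^ (3 : ℕ))
    (γ : ℝ) (hγ : 0 < γ) :
    ∃ fbar : ℝ → ℝ,
      PiecewiseLinear (Set.Icc a (a + L)) (Nat.floor (2 * ((k : ℝ) + γ))) fbar ∧
      PiecewiseMCC (Set.Icc a (a + L)) k fbar ∧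
      (∑ i, |f (x i) - fbar (x i)|) / n ≤ W / γ ^ 2 + 2 * V / n := by
  set δ := L / n with hδdef
  have hn' : (0 : ℝ) < n := Nat.cast_pos.2 hn
  have hδ : 0 < δ := div_pos hL hn'
  have hnδ : n * δ = L := mul_div_cancel₀ L hn'.ne'
  have hx := equispaced_eq hn hxeq
  set x₀ := x ⟨0, hn⟩
  have hx₀ : a ≤ x₀ := (hxmem _).1
  have hx₁ : x₀ - δ ≤ a := by
    have h1 := (hxmem ⟨n - 1, Nat.sub_lt hn one_pos⟩).2
    rw [hx, Nat.cast_pred hn] at h1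
    linarith
  have hcount := countBound_of_equispaced hδ hx
  have hb := fun J hJ => (hP.1 J hJ).1.interval_bounds (hP.1 J hJ).2.1 (hP.1 J hJ).2.2
  set Λ : Set ℝ → ℝ := fun J => realVarOn f J *
    linIndex (dr J) (dl J) ((f (sSup J) - f (sInf J)) / (sSup J - sInf J)) with hΛ
  have hpiece : ∀ J ∈ P, Λ J ∈ Icc 0 (realVarOn f J) ∧ ∀ m : ℕ, 0 < m →
      HasApprox f (sInf J) (sSup J) (m + m) ((sSup J - sInf J) * Λ J / m ^ 2) := by
    intro J hJ
    obtain ⟨hlt, -, -, hcl, hsub⟩ := hb J hJ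
    have hfJ := hf J hJ
    rw [hcl] at hfJ
    simp only [hΛ]
    rw [realVarOn_eq hlt.le hcl hfJ.1]
    exact hasApprox_of_monotone_or_antitone hlt (hfcont.mono hsub) hfJ.1 hfJ.2
      ⟨hdr J hJ, hdl J hJ⟩
  set w : Set ℝ → ℝ := fun J => nPts x J * Λ J / n with hw
  have hw0 : ∀ J ∈ P, 0 ≤ w J := fun J hJ =>
    div_nonneg (mul_nonneg (Nat.cast_nonneg _) (hpiece J hJ).1.1) hn'.le
  have hWw : W = (∑ J ∈ P, w J ^ ((1 : ℝ) / 3)) ^ 3 := by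
    rw [hW]
    simp only [hw, hΛ, mul_assoc]
  obtain ⟨m, hm0, hmsum, hmW⟩ := exists_allocation P w hw0 hγ
  have hg : ∀ J, ∃ g : ℝ → ℝ, J ∈ P → ContinuousOn g (closure J) ∧
      (MonotoneOn g (closure J) ∨ AntitoneOn g (closure J)) ∧
      (ConvexOn ℝ (closure J) g ∨ ConcaveOn ℝ (closure J) g) ∧
      g (sInf J) = f (sInf J) ∧ g (sSup J) = f (sSup J) ∧
      AffineOnFibers g (closure J) (m J + m J) ∧
      ∑ i with x i ∈ J, |f (x i) - g (x i)| ≤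
        δ⁻¹ * ((sSup J - sInf J) * Λ J / m J ^ 2) + realVarOn f J := by
    intro J
    by_cases hJ : J ∈ P
    swap
    · exact ⟨0, fun h => absurd h hJ⟩
    obtain ⟨hlt, -, hIcc, hcl, -⟩ := hb J hJ
    have hfJ := (hf J hJ).1
    rw [hcl] at hfJ
    obtain ⟨g, h1, h2, h3, h4, h5, h6, h7⟩ := (hpiece J hJ).2 (m J) (hm0 J)
    refine ⟨g, fun _ => ?_⟩
    rw [hcl, realVarOn_eq hlt.le hcl hfJ]
    refine ⟨h1, h2, h3, h4, h5, h6, h7 _ _ x _ (inv_nonneg.2 hδ.le) (fun u v huv => ?_)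
      fun i hi => hIcc (Finset.mem_filter.1 hi).2⟩
    refine le_trans ?_ (hcount u v huv)
    exact_mod_cast Finset.card_le_card (Finset.filter_subset_filter _ (Finset.subset_univ _))
  choose g hg using hg
  obtain ⟨h, hh⟩ := hP.exists_glue g
  have hcl := hP.glue_eq_on_closure hh (fun J hJ => (hg J hJ).2.2.2.1)
    fun J hJ => (hg J hJ).2.2.2.2.1
  have hcont : ContinuousOn h (Icc a (a + L)) :=
    hP.continuousOn fun J hJ => (hg J hJ).1.congr (hcl J hJ)
  refine ⟨h, hP.piecewiseLinear (N := fun J => m J + m J) hcont (fun J hJ => ?_) ?_,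
    ⟨hcont, P, hPcard, hP, fun J hJ => ⟨?_, ?_⟩⟩, ?_⟩
  · exact (hg J hJ).2.2.2.2.2.1.congr_subset (hP.1 J hJ).1 subset_closure (hh J hJ)
  · apply Nat.le_floor
    rw [Finset.sum_add_distrib]
    have : (P.card : ℝ) ≤ k := Nat.cast_le.2 hPcard
    push_cast at hmsum ⊢
    linarith
  · have he : EqOn (g J) h (closure J) := fun y hy => (hcl J hJ y hy).symm
    exact (hg J hJ).2.1.imp (fun h => h.congr he) fun h => h.congr he
  · have he : EqOn (g J) h (closure J) := fun y hy => (hcl J hJ y hy).symm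
    exact (hg J hJ).2.2.1.imp (fun h => h.congr he) fun h => h.congr he
  · have herr : ∀ J ∈ P, ∑ i with x i ∈ J, |f (x i) - h (x i)| ≤
        n * (w J / m J ^ 2) + 2 * realVarOn f J := by
      intro J hJ
      obtain ⟨-, hIoo, -, hclJ, hsub⟩ := hb J hJ
      have h1 : ∑ i with x i ∈ J, |f (x i) - h (x i)| =
          ∑ i with x i ∈ J, |f (x i) - g J (x i)| :=
        Finset.sum_congr rfl fun i hi => by rw [hh J hJ _ (Finset.mem_filter.1 hi).2]
      rw [h1]
      refine (hg J hJ).2.2.2.2.2.2.trans ?_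
      obtain ⟨⟨hΛ0, hΛV⟩, -⟩ := hpiece J hJ
      have hlt := (hb J hJ).1
      have h2 : δ⁻¹ * (sSup J - sInf J) ≤ nPts x J + 1 :=
        le_nPts_add_one hδ hx hIoo (hx₁.trans (hsub ⟨le_rfl, hlt.le⟩).1)
          ((hsub ⟨hlt.le, le_rfl⟩).2.trans (by linarith))
      have h3 : (1 : ℝ) ≤ m J ^ 2 := one_le_pow₀ (Nat.one_le_cast.2 (hm0 J))
      have h4 : 0 ≤ Λ J / m J ^ 2 := div_nonneg hΛ0 (by positivity)
      have h5 : Λ J / m J ^ 2 ≤ realVarOn f J := (div_le_self hΛ0 h3).trans hΛV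
      have h6 := mul_le_mul_of_nonneg_right h2 h4
      have h7 : n * (w J / m J ^ 2) = nPts x J * (Λ J / m J ^ 2) := by
        simp only [hw]
        field_simp
      have h8 : δ⁻¹ * ((sSup J - sInf J) * Λ J / m J ^ 2) =
        δ⁻¹ * (sSup J - sInf J) * (Λ J / m J ^ 2) := by ring
      rw [h7, h8]
      linarith
    have hsplit : ∑ i, |f (x i) - h (x i)| = ∑ J ∈ P, ∑ i with x i ∈ J, |f (x i) - h (x i)| := by
      simp only [Finset.sum_filter]
      rw [Finset.sum_comm]
      refine Finset.sum_congr rfl fun i _ => ?_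
      obtain ⟨J, ⟨hJ, hxJ⟩, huniq⟩ := hP.2 (x i) (hxmem i)
      rw [Finset.sum_eq_single_of_mem J hJ fun J' hJ' hne =>
        if_neg fun hxJ' => hne (huniq J' ⟨hJ', hxJ'⟩), if_pos hxJ]
    rw [hsplit, div_le_iff₀ hn']
    refine (Finset.sum_le_sum herr).trans ?_
    rw [Finset.sum_add_distrib, ← Finset.mul_sum, ← Finset.mul_sum, ← hV, add_mul,
      div_mul_cancel₀ _ hn'.ne', mul_comm (W / γ ^ 2), hWw]
    gcongr
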